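/- Quantitative weak-type (α/s, α/s) inequality: let 0 < α ≤ s. For every f with ∫_K |f|^{α/s} dH^α_μ < ∞ and every t > 0, H^α_μ({x ∈ K : M^μ_D f(x) > t}) ≤ 4 (s/α)^{α/s} t^{−α/s} ∫_K |f|^{α/s} dH^α_μ. -/

import Mathlib

open MeasureTheory Set Filter
open scoped ENNReal NNReal Topology

noncomputable section

abbrev Pt (d : ℕ) := EuclideanSpace ℝ (Fin d)

/-- An iterated function system of contractive similitudes on ℝ^d with attractor `K`
satisfying the strong separation condition. -/
structure IFS (d m : ℕ) where
  S : Fin m → Pt d → Pt d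
  r : Fin m → ℝ
  r_pos : ∀ i, 0 < r i
  r_lt_one : ∀ i, r i < 1
  similitude : ∀ i x y, dist (S i x) (S i y) = r i * dist x y
  K : Set (Pt d)
  K_nonempty : K.Nonempty
  K_compact : IsCompact K
  K_invariant : K = ⋃ i, S i '' K
  ssc : Pairwise fun i j => Disjoint (S i '' K) (S j '' K)

namespace IFS

variable {d m : ℕ}

/-- The composition `S_{i₁} ∘ ⋯ ∘ S_{iₙ}` for the word `w = i₁ ⋯ iₙ`. -/
def cylMap (Φ : IFS d m) (w : List (Fin m)) : Pt d → Pt d :=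
  w.foldr (fun i g => Φ.S i ∘ g) id

/-- The basic cube (cylinder set) `K_w = S_{i₁} ∘ ⋯ ∘ S_{iₙ}(K)`. -/
def cyl (Φ : IFS d m) (w : List (Fin m)) : Set (Pt d) :=
  Φ.cylMap w '' Φ.K

/-- `μ` is the self-similar probability measure associated with the probability
vector `p` (with all `p i > 0`), i.e. `μ = ∑ i, p i • μ ∘ S i ⁻¹`, supported on `K`. -/
def SelfSimilar (Φ : IFS d m) (p : Fin m → ℝ≥0∞) (μ : Measure (Pt d)) : Prop :=
  (∑ i, p i = 1) ∧ (∀ i, 0 < p i) ∧ IsProbabilityMeasure μ ∧ μ Φ.K = 1 ∧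
    μ = ∑ i, p i • μ.map (Φ.S i)

/-- The α-dimensional Hausdorff content on `K` associated with `μ`, defined via
coverings by countable families of basic cubes; `s` is the Hausdorff dimension of `K`. -/
def hContent (Φ : IFS d m) (μ : Measure (Pt d)) (s α : ℝ) (E : Set (Pt d)) : ℝ≥0∞ :=
  ⨅ (C : Set (List (Fin m))) (_ : C.Countable) (_ : E ⊆ ⋃ w ∈ C, Φ.cyl w),
    ∑' w : C, μ (Φ.cyl w.1) ^ (α / s)

/-- The dyadic-type Hardy–Littlewood maximal operator over basic cubes containing `x`. -/
def maxOp (Φ : IFS d m) (μ : Measure (Pt d)) (f : Pt d → ℝ) (x : Pt d) : ℝ≥0∞ :=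
  ⨆ (w : List (Fin m)) (_ : x ∈ Φ.cyl w),
    (μ (Φ.cyl w))⁻¹ * ∫⁻ y in Φ.cyl w, ENNReal.ofReal |f y| ∂μ

end IFS

/-- The Choquet integral of `g` over `E` with respect to the monotone set function `ν`. -/
def choquetInt {X : Type*} (ν : Set X → ℝ≥0∞) (E : Set X) (g : X → ℝ≥0∞) : ℝ≥0∞ :=
  ∫⁻ t in Set.Ioi (0 : ℝ), ν {x ∈ E | ENNReal.ofReal t < g x}

/-- `log⁺ t = max (0, log t)`. -/
def posLog (t : ℝ) : ℝ := max 0 (Real.log t)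

section Words

variable {ι : Type*}

/-- The words of `A` none of whose proper prefixes lies in `A`. -/
def prefixMinimal (A : Set (List ι)) : Set (List ι) :=
  {w ∈ A | ∀ v ∈ A, v <+: w → v = w}

theorem isAntichain_prefixMinimal (A : Set (List ι)) :
    IsAntichain (· <+: ·) (prefixMinimal A) :=
  fun _ hv _ hw hne h => hne (hw.2 _ hv.1 h)

theorem exists_mem_prefixMinimal {A : Set (List ι)} {w : List ι} (hw : w ∈ A) :
    ∃ v ∈ prefixMinimal A, v <+: w := by
  induction hn : w.length using Nat.strong_induction_on generalizing w with
  | _ n ih =>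
    by_cases h : ∀ v ∈ A, v <+: w → v = w
    · exact ⟨w, ⟨hw, h⟩, List.prefix_rfl⟩
    · push Not at h
      obtain ⟨v, hv, hvw, hne⟩ := h
      have hlt : v.length < n := by
        rcases hvw.length_le.lt_or_eq with h | h
        · omega
        · exact absurd (hvw.eq_of_length h) hne
      obtain ⟨u, hu, huv⟩ := ih _ hlt hv rfl
      exact ⟨u, hu, huv.trans hvw⟩

/-- In an antichain for the prefix order, a given word has at most one prefix. -/
theorem tsum_indicator_prefix_le {B : Set (List ι)} (hB : IsAntichain (· <+: ·) B)
    (v : List ι) (c : ℝ≥0∞) :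
    ∑' w, (B ∩ {w | w <+: v}).indicator (fun _ => c) w ≤ c := by
  have hsub : (B ∩ {w | w <+: v}).Subsingleton := by
    rintro w ⟨hw, hwv⟩ u ⟨hu, huv⟩
    by_contra hne
    rcases le_total w.length u.length with h | h
    · exact hB hw hu hne (List.prefix_of_prefix_length_le hwv huv h)
    · exact hB hu hw (Ne.symm hne) (List.prefix_of_prefix_length_le huv hwv h)
  rcases hsub.eq_empty_or_singleton with h | ⟨w, h⟩
  · simp [h]
  · rw [h, ← tsum_subtype {w} (fun _ => c), tsum_singleton w (fun _ => c)]

/-- The packing condition: the total weight of the words of `F` extending `w` is at most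
twice the weight of `w`. -/
def IsPacking (a : List ι → ℝ≥0∞) (F : Set (List ι)) : Prop :=
  ∀ w, ∑' v, (F ∩ {v | w <+: v}).indicator a v ≤ 2 * a w

theorem exists_maximal_isPacking (a : List ι → ℝ≥0∞) (J : Set (List ι)) :
    ∃ F, Maximal (fun F => F ⊆ J ∧ IsPacking a F) F := by
  refine zorn_subset {F | F ⊆ J ∧ IsPacking a F} fun c hc hchain => ?_
  rcases c.eq_empty_or_nonempty with rfl | hne
  · exact ⟨∅, ⟨empty_subset _, fun w => by simp⟩, by simp⟩
  refine ⟨⋃₀ c, ⟨sUnion_subset fun F hF => (hc hF).1, fun w => ?_⟩,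
    fun F hF => subset_sUnion_of_mem hF⟩
  rw [ENNReal.tsum_eq_iSup_sum]
  refine iSup_le fun T => ?_
  obtain ⟨F, hF, hTF⟩ := hchain.directedOn.exists_mem_subset_of_finite_of_subset_sUnion hne
    (T.finite_toSet.inter_of_left (⋃₀ c)) inter_subset_right
  calc ∑ v ∈ T, (⋃₀ c ∩ {v | w <+: v}).indicator a v
      ≤ ∑ v ∈ T, (F ∩ {v | w <+: v}).indicator a v := by
        refine Finset.sum_le_sum fun v hv => ?_
        by_cases hvc : v ∈ ⋃₀ c ∩ {v | w <+: v}
        · have hvF : v ∈ F ∩ {v | w <+: v} := ⟨hTF ⟨hv, hvc.1⟩, hvc.2⟩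
          rw [indicator_of_mem hvc, indicator_of_mem hvF]
        · rw [indicator_of_notMem hvc]
          exact zero_le
    _ ≤ ∑' v, (F ∩ {v | w <+: v}).indicator a v := ENNReal.sum_le_tsum _
    _ ≤ 2 * a w := (hc hF).2 w

/-- A maximal packing subfamily of `J` controls a family `B` such that every word
of `J` extends some word of `B`. -/
theorem exists_packing_dominating {a : List ι → ℝ≥0∞} (ha : ∀ w, a w ≠ ∞)
    (hmono : ∀ v w, v <+: w → a w ≤ a v) (J : Set (List ι)) :
    ∃ F ⊆ J, IsPacking a F ∧ ∃ B : Set (List ι), (∀ v ∈ J, ∃ w ∈ B, w <+: v) ∧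
      ∑' w : B, a w ≤ ∑' v : F, a v := by
  obtain ⟨F, hF⟩ := exists_maximal_isPacking a J
  have hpack : IsPacking a F := hF.prop.2
  refine ⟨F, hF.prop.1, hpack,
    prefixMinimal {w | a w ≤ ∑' v, (F ∩ {v | w <+: v}).indicator a v}, fun v hv => ?_, ?_⟩
  · suffices h : ∃ w, a w ≤ ∑' u, (F ∩ {u | w <+: u}).indicator a u ∧ w <+: v by
      obtain ⟨w, hw, hwv⟩ := h
      obtain ⟨u, hu, huw⟩ := exists_mem_prefixMinimal
        (A := {w | a w ≤ ∑' v, (F ∩ {v | w <+: v}).indicator a v}) hw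
      exact ⟨u, hu, huw.trans hwv⟩
    by_cases hvF : v ∈ F
    · refine ⟨v, ?_, List.prefix_rfl⟩
      calc a v = (F ∩ {u | v <+: u}).indicator a v :=
            (indicator_of_mem (show v ∈ F ∩ {u | v <+: u} from ⟨hvF, List.prefix_rfl⟩) a).symm
        _ ≤ _ := ENNReal.le_tsum v
    · have hnot : ¬ IsPacking a (insert v F) := fun h =>
        hvF (hF.le_of_ge ⟨insert_subset hv hF.prop.1, h⟩ (subset_insert v F) (mem_insert v F))
      unfold IsPacking at hnot
      push Not at hnot
      obtain ⟨w, hw⟩ := hnot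
      by_cases hwv : w <+: v
      · refine ⟨w, ?_, hwv⟩
        have hset : insert v F ∩ {u | w <+: u} = {v} ∪ (F ∩ {u | w <+: u}) := by
          rw [← insert_eq, insert_inter_of_mem (show v ∈ {u | w <+: u} from hwv)]
        have hdisj : Disjoint {v} (F ∩ {u | w <+: u}) :=
          disjoint_singleton_left.2 fun h => hvF h.1
        have hsum : ∑' u, (insert v F ∩ {u | w <+: u}).indicator a u =
            a v + ∑' u, (F ∩ {u | w <+: u}).indicator a u := by
          rw [hset, indicator_union_of_disjoint hdisj, ENNReal.tsum_add,
            ← tsum_subtype {v} a, tsum_singleton v a]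
        rw [hsum, two_mul] at hw
        refine (ENNReal.add_le_add_iff_left (ha w)).1 (hw.le.trans ?_)
        gcongr
        exact hmono w v hwv
      · have hset : insert v F ∩ {u | w <+: u} = F ∩ {u | w <+: u} :=
          insert_inter_of_notMem hwv
        rw [hset] at hw
        exact absurd (hpack w) hw.not_ge
  · set B := prefixMinimal {w | a w ≤ ∑' v, (F ∩ {v | w <+: v}).indicator a v}
    rw [tsum_subtype F a]
    calc ∑' w : B, a w
        ≤ ∑' w : B, ∑' v, (F ∩ {v | w.1 <+: v}).indicator a v :=
          ENNReal.tsum_le_tsum fun w => w.2.1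
      _ = ∑' v, ∑' w, B.indicator (fun w => (F ∩ {v | w <+: v}).indicator a v) w := by
          rw [ENNReal.tsum_comm]
          exact tsum_congr fun v =>
            tsum_subtype B fun w => (F ∩ {v | w <+: v}).indicator a v
      _ ≤ ∑' v, F.indicator a v := by
          refine ENNReal.tsum_le_tsum fun v => ?_
          have hanti : IsAntichain (· <+: ·) B := isAntichain_prefixMinimal _
          refine le_trans (ENNReal.tsum_le_tsum fun w => ?_)
            (tsum_indicator_prefix_le hanti v (F.indicator a v))
          classical
          simp only [indicator_apply, mem_inter_iff, mem_ofPred_eq]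
          grind

end Words

theorem ENNReal.rpow_inv_eq_mul_rpow {β : ℝ} (hβ : 0 < β) (hβ1 : β ≤ 1) (y : ℝ≥0∞) :
    y ^ β⁻¹ = y * y ^ (β⁻¹ - 1) := by
  have hexp : 0 ≤ β⁻¹ - 1 := sub_nonneg.2 ((one_le_inv₀ hβ).2 hβ1)
  conv_rhs => enter [1]; rw [← ENNReal.rpow_one y]
  rw [← ENNReal.rpow_add_of_nonneg _ _ zero_le_one hexp, add_sub_cancel]

theorem tsum_le_tsum_rpow_rpow_inv {ι : Type*} (x : ι → ℝ≥0∞) {β : ℝ} (hβ : 0 < β)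
    (hβ1 : β ≤ 1) : ∑' i, x i ≤ (∑' i, x i ^ β) ^ β⁻¹ := by
  have hexp : 0 ≤ β⁻¹ - 1 := sub_nonneg.2 ((one_le_inv₀ hβ).2 hβ1)
  rw [ENNReal.rpow_inv_eq_mul_rpow hβ hβ1, ← ENNReal.tsum_mul_right]
  refine ENNReal.tsum_le_tsum fun i => ?_
  calc x i = (x i ^ β) ^ β⁻¹ := (ENNReal.rpow_rpow_inv hβ.ne' _).symm
    _ = x i ^ β * (x i ^ β) ^ (β⁻¹ - 1) := ENNReal.rpow_inv_eq_mul_rpow hβ hβ1 _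
    _ ≤ _ := by gcongr; exact ENNReal.le_tsum (f := fun i => x i ^ β) i

/-- The integral of an antitone function against `u ↦ u ^ (β⁻¹ - 1)`. -/
theorem lintegral_rpow_inv_mul_le {k : ℝ → ℝ≥0∞} (hk : Antitone k) {β : ℝ} (hβ : 0 < β)
    (hβ1 : β ≤ 1) :
    ∫⁻ u in Ioi (0 : ℝ), k u ^ β⁻¹ * ENNReal.ofReal (u ^ (β⁻¹ - 1)) ≤
      (∫⁻ u in Ioi (0 : ℝ), k u) ^ β⁻¹ := by
  have hexp : 0 ≤ β⁻¹ - 1 := sub_nonneg.2 ((one_le_inv₀ hβ).2 hβ1)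
  rw [ENNReal.rpow_inv_eq_mul_rpow hβ hβ1 (∫⁻ u in Ioi (0 : ℝ), k u),
    ← lintegral_mul_const _ hk.measurable]
  refine setLIntegral_mono' measurableSet_Ioi fun u hu => ?_
  have hu0 : (0 : ℝ) < u := hu
  have hmarkov : k u * ENNReal.ofReal u ≤ ∫⁻ u in Ioi (0 : ℝ), k u := by
    calc k u * ENNReal.ofReal u = ∫⁻ _ in Ioc 0 u, k u := by simp
      _ ≤ ∫⁻ v in Ioc 0 u, k v := setLIntegral_mono' measurableSet_Ioc fun v hv => hk hv.2
      _ ≤ _ := lintegral_mono_set Ioc_subset_Ioi_self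
  rw [ENNReal.rpow_inv_eq_mul_rpow hβ hβ1 (k u), mul_assoc, ← ENNReal.ofReal_rpow_of_pos hu0,
    ← ENNReal.mul_rpow_of_nonneg _ _ hexp]
  gcongr

namespace IFS

variable {d m : ℕ} (Φ : IFS d m)

theorem cylMap_append (u v : List (Fin m)) : Φ.cylMap (u ++ v) = Φ.cylMap u ∘ Φ.cylMap v := by
  induction u with
  | nil => rfl
  | cons i u ih =>
    change Φ.S i ∘ Φ.cylMap (u ++ v) = _
    rw [ih]
    rfl

theorem cyl_cons (i : Fin m) (w : List (Fin m)) : Φ.cyl (i :: w) = Φ.S i '' Φ.cyl w :=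
  image_comp (Φ.S i) (Φ.cylMap w) Φ.K

theorem S_injective (i : Fin m) : Function.Injective (Φ.S i) := fun x y h => by
  have := Φ.similitude i x y
  rw [h, dist_self, zero_eq_mul] at this
  exact dist_eq_zero.1 (this.resolve_left (Φ.r_pos i).ne')

theorem cyl_subset_K (w : List (Fin m)) : Φ.cyl w ⊆ Φ.K := by
  induction w with
  | nil => simp [cyl, cylMap]
  | cons i w ih =>
    rw [cyl_cons]
    conv_rhs => rw [Φ.K_invariant]
    exact (image_mono ih).trans (subset_iUnion (fun i => Φ.S i '' Φ.K) i)

theorem cyl_antitone {v w : List (Fin m)} (h : v <+: w) : Φ.cyl w ⊆ Φ.cyl v := by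
  obtain ⟨u, rfl⟩ := h
  rw [cyl, cylMap_append, image_comp]
  exact image_mono (Φ.cyl_subset_K u)

theorem prefix_or_prefix_of_mem_cyl {v w : List (Fin m)} {x : Pt d} (hv : x ∈ Φ.cyl v)
    (hw : x ∈ Φ.cyl w) : v <+: w ∨ w <+: v := by
  induction v generalizing w x with
  | nil => exact Or.inl (by simp)
  | cons i v ih =>
    cases w with
    | nil => exact Or.inr (by simp)
    | cons j w =>
      rw [cyl_cons] at hv hw
      obtain ⟨y, hy, rfl⟩ := hv
      obtain ⟨z, hz, hzy⟩ := hw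
      have hij : i = j := by
        by_contra hne
        exact disjoint_left.1 (Φ.ssc hne) (mem_image_of_mem _ (Φ.cyl_subset_K v hy))
          (hzy ▸ mem_image_of_mem _ (Φ.cyl_subset_K w hz))
      subst hij
      obtain rfl := Φ.S_injective i hzy
      simpa using ih hy hz

variable (μ : Measure (Pt d)) (s α : ℝ)

theorem hContent_le {E : Set (Pt d)} (C : Set (List (Fin m)))
    (hE : E ⊆ ⋃ w ∈ C, Φ.cyl w) :
    Φ.hContent μ s α E ≤ ∑' w : C, μ (Φ.cyl w.1) ^ (α / s) :=
  iInf₂_le_of_le C C.to_countable (iInf_le _ hE)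

theorem hContent_mono {E E' : Set (Pt d)} (h : E ⊆ E') :
    Φ.hContent μ s α E ≤ Φ.hContent μ s α E' :=
  le_iInf fun C => le_iInf fun _ => le_iInf fun hC => Φ.hContent_le μ s α C (h.trans hC)

theorem antitone_hContent_superlevel (E : Set (Pt d)) (g : Pt d → ℝ≥0∞) :
    Antitone fun u : ℝ => Φ.hContent μ s α {x ∈ E | ENNReal.ofReal u < g x} :=
  fun _ _ huv => Φ.hContent_mono μ s α fun _ hx =>
    ⟨hx.1, (ENNReal.ofReal_le_ofReal huv).trans_lt hx.2⟩

theorem measure_le_hContent_rpow (hβ : 0 < α / s) (hβ1 : α / s ≤ 1) (E : Set (Pt d)) :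
    μ E ≤ Φ.hContent μ s α E ^ (α / s)⁻¹ := by
  rw [← ENNReal.rpow_inv_le_iff (inv_pos.2 hβ), inv_inv]
  refine le_iInf fun C => le_iInf fun _ => le_iInf fun hC => ?_
  rw [← ENNReal.le_rpow_inv_iff hβ]
  calc μ E ≤ μ (⋃ w ∈ C, Φ.cyl w) := measure_mono hC
    _ ≤ ∑' w : C, μ (Φ.cyl w.1) := measure_biUnion_le μ C.to_countable _
    _ ≤ _ := tsum_le_tsum_rpow_rpow_inv _ hβ hβ1

/-- The Hausdorff content is almost superadditive along a packing family of disjoint cubes. -/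
theorem tsum_hContent_inter_le {F : Set (List (Fin m))}
    (hF : IsAntichain (· <+: ·) F)
    (hpack : IsPacking (fun w => μ (Φ.cyl w) ^ (α / s)) F) (E : Set (Pt d)) :
    ∑' v : F, Φ.hContent μ s α (E ∩ Φ.cyl v.1) ≤ 3 * Φ.hContent μ s α E := by
  set a : List (Fin m) → ℝ≥0∞ := fun w => μ (Φ.cyl w) ^ (α / s)
  rw [← ENNReal.div_le_iff' (by simp) (by simp)]
  refine le_iInf fun C => le_iInf fun _ => le_iInf fun hC => ?_
  rw [ENNReal.div_le_iff' (by simp) (by simp)]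
  have hcube : ∀ v, Φ.hContent μ s α (E ∩ Φ.cyl v) ≤
      ∑' w : C, ({v | w.1 <+: v}.indicator a v + {v | v <+: w.1}.indicator (fun _ => a w) v) := by
    intro v
    by_cases hv : ∃ w ∈ C, w <+: v
    · obtain ⟨w, hw, hwv⟩ := hv
      calc Φ.hContent μ s α (E ∩ Φ.cyl v) ≤ ∑' u : ({v} : Set (List (Fin m))), a u :=
            Φ.hContent_le μ s α {v} (by simp)
        _ = {v | w <+: v}.indicator a v := by
            rw [tsum_singleton v a, indicator_of_mem (show v ∈ {v | w <+: v} from hwv)]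
        _ ≤ _ := le_self_add
        _ ≤ _ := ENNReal.le_tsum (f := fun w : C => {v | w.1 <+: v}.indicator a v +
            {v | v <+: w.1}.indicator (fun _ => a w) v) ⟨w, hw⟩
    · push Not at hv
      calc Φ.hContent μ s α (E ∩ Φ.cyl v) ≤ ∑' u : ↥(C ∩ {u | v <+: u}), a u := by
            refine Φ.hContent_le μ s α _ fun x hx => ?_
            obtain ⟨w, hw, hxw⟩ := mem_iUnion₂.1 (hC hx.1)
            exact mem_iUnion₂.2 ⟨w, ⟨hw,
              (Φ.prefix_or_prefix_of_mem_cyl hx.2 hxw).resolve_right (hv w hw)⟩, hxw⟩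
        _ = ∑' w : C, {v | v <+: w.1}.indicator (fun _ => a w) v := by
            rw [tsum_subtype, tsum_subtype C fun w => {v | v <+: w}.indicator (fun _ => a w) v]
            refine tsum_congr fun w => ?_
            classical
            simp only [indicator_apply, mem_inter_iff, mem_ofPred_eq]
            grind
        _ ≤ _ := ENNReal.tsum_le_tsum fun w => le_add_self
  calc ∑' v : F, Φ.hContent μ s α (E ∩ Φ.cyl v.1)
      ≤ ∑' v : F, ∑' w : C,
        ({v | w.1 <+: v}.indicator a v.1 + {v | v <+: w.1}.indicator (fun _ => a w) v.1) :=
        ENNReal.tsum_le_tsum fun v => hcube v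
    _ = ∑' w : C, (∑' v, (F ∩ {v | w.1 <+: v}).indicator a v +
        ∑' v, (F ∩ {v | v <+: w.1}).indicator (fun _ => a w) v) := by
        rw [ENNReal.tsum_comm]
        refine tsum_congr fun w => ?_
        rw [ENNReal.tsum_add, tsum_subtype F, tsum_subtype F, indicator_indicator,
          indicator_indicator]
    _ ≤ ∑' w : C, 3 * a w := by
        refine ENNReal.tsum_le_tsum fun w => ?_
        calc _ ≤ 2 * a w + a w := add_le_add (hpack w) (tsum_indicator_prefix_le hF _ _)
          _ = 3 * a w := by ring
    _ = 3 * ∑' w : C, a w := ENNReal.tsum_mul_left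

theorem tsum_choquetInt_cyl_le {F : Set (List (Fin m))}
    (hF : IsAntichain (· <+: ·) F)
    (hpack : IsPacking (fun w => μ (Φ.cyl w) ^ (α / s)) F) (g : Pt d → ℝ≥0∞) :
    ∑' v : F, choquetInt (Φ.hContent μ s α) (Φ.cyl v.1) g ≤
      3 * choquetInt (Φ.hContent μ s α) Φ.K g := by
  unfold choquetInt
  rw [← lintegral_tsum fun v : F =>
      (Φ.antitone_hContent_superlevel μ s α (Φ.cyl v.1) g).measurable.aemeasurable,
    ← lintegral_const_mul _ (Φ.antitone_hContent_superlevel μ s α Φ.K g).measurable]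
  refine lintegral_mono fun u => ?_
  refine le_trans (ENNReal.tsum_le_tsum fun v => Φ.hContent_mono μ s α ?_)
    (Φ.tsum_hContent_inter_le μ s α hF hpack {x ∈ Φ.K | ENNReal.ofReal u < g x})
  exact fun x hx => ⟨⟨Φ.cyl_subset_K _ hx.1, hx.2⟩, hx.1⟩

theorem setLIntegral_le_choquetInt_rpow (hβ : 0 < α / s) (hβ1 : α / s ≤ 1) {f : Pt d → ℝ}
    (hf : Measurable f) (Q : Set (Pt d)) :
    ∫⁻ y in Q, ENNReal.ofReal |f y| ∂μ ≤ ENNReal.ofReal (α / s)⁻¹ *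
      choquetInt (Φ.hContent μ s α) Q (fun x => ENNReal.ofReal |f x| ^ (α / s)) ^ (α / s)⁻¹ := by
  set β := α / s
  have hfβ : Measurable fun y => |f y| ^ β := (continuous_abs.measurable.comp hf).pow_const β
  calc ∫⁻ y in Q, ENNReal.ofReal |f y| ∂μ
      = ∫⁻ y in Q, ENNReal.ofReal ((|f y| ^ β) ^ β⁻¹) ∂μ := by
        simp_rw [Real.rpow_rpow_inv (abs_nonneg _) hβ.ne']
    _ = ENNReal.ofReal β⁻¹ * ∫⁻ u in Ioi (0 : ℝ), (μ.restrict Q) {y | u < |f y| ^ β} *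
          ENNReal.ofReal (u ^ (β⁻¹ - 1)) :=
        lintegral_rpow_eq_lintegral_meas_lt_mul _
          (Eventually.of_forall fun y => Real.rpow_nonneg (abs_nonneg _) _)
          hfβ.aemeasurable (inv_pos.2 hβ)
    _ ≤ ENNReal.ofReal β⁻¹ * ∫⁻ u in Ioi (0 : ℝ),
          Φ.hContent μ s α {x ∈ Q | ENNReal.ofReal u < ENNReal.ofReal |f x| ^ β} ^ β⁻¹ *
          ENNReal.ofReal (u ^ (β⁻¹ - 1)) := by
        gcongr ENNReal.ofReal β⁻¹ * ?_
        refine setLIntegral_mono' measurableSet_Ioi fun u hu => ?_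
        gcongr
        refine le_trans ?_ (Φ.measure_le_hContent_rpow μ s α hβ hβ1 _)
        rw [Measure.restrict_apply (measurableSet_lt measurable_const hfβ)]
        refine measure_mono fun x hx => ⟨hx.2, ?_⟩
        rw [ENNReal.ofReal_rpow_of_nonneg (abs_nonneg _) hβ.le]
        exact (ENNReal.ofReal_lt_ofReal_iff_of_nonneg (le_of_lt hu)).2 hx.1
    _ ≤ _ := by
        gcongr
        exact lintegral_rpow_inv_mul_le (Φ.antitone_hContent_superlevel μ s α Q _) hβ hβ1

/-- The weight of a cube on which the average of `|f|` exceeds `t`. -/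
theorem measure_cyl_rpow_le (hβ : 0 < α / s) (hβ1 : α / s ≤ 1) {f : Pt d → ℝ}
    (hf : Measurable f) {t : ℝ} (ht : 0 < t) {w : List (Fin m)}
    (hw : ENNReal.ofReal t < (μ (Φ.cyl w))⁻¹ * ∫⁻ y in Φ.cyl w, ENNReal.ofReal |f y| ∂μ) :
    μ (Φ.cyl w) ^ (α / s) ≤ ENNReal.ofReal ((s / α) ^ (α / s) * t ^ (-(α / s))) *
      choquetInt (Φ.hContent μ s α) (Φ.cyl w) (fun x => ENNReal.ofReal |f x| ^ (α / s)) := by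
  have hint := Φ.setLIntegral_le_choquetInt_rpow μ s α hβ hβ1 hf (Φ.cyl w)
  set I := choquetInt (Φ.hContent μ s α) (Φ.cyl w) (fun x => ENNReal.ofReal |f x| ^ (α / s))
  have hmul : μ (Φ.cyl w) * ENNReal.ofReal t ≤ ENNReal.ofReal (α / s)⁻¹ * I ^ (α / s)⁻¹ := by
    refine le_trans ?_ hint
    refine ENNReal.mul_le_of_le_div' ?_
    rw [ENNReal.div_eq_inv_mul]
    exact hw.le
  have hle : μ (Φ.cyl w) ≤ ENNReal.ofReal (s / α * t⁻¹) * I ^ (α / s)⁻¹ := by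
    refine ((ENNReal.le_div_iff_mul_le (Or.inl (by simpa using ht)) (Or.inl (by simp))).2
      hmul).trans_eq ?_
    rw [ENNReal.ofReal_mul' (inv_nonneg.2 ht.le), ENNReal.ofReal_inv_of_pos ht, inv_div,
      ENNReal.div_eq_inv_mul]
    ring
  calc μ (Φ.cyl w) ^ (α / s) ≤ (ENNReal.ofReal (s / α * t⁻¹) * I ^ (α / s)⁻¹) ^ (α / s) := by
        gcongr
    _ = _ := by
        have hsα : 0 ≤ s / α := by rw [← inv_div]; exact (inv_pos.2 hβ).le
        rw [ENNReal.mul_rpow_of_nonneg _ _ hβ.le, ENNReal.rpow_inv_rpow hβ.ne',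
          ENNReal.ofReal_rpow_of_nonneg (by positivity) hβ.le,
          Real.mul_rpow hsα (inv_nonneg.2 ht.le), Real.inv_rpow ht.le, Real.rpow_neg ht.le]

end IFS

/-- Quantitative weak type `(α/s, α/s)` inequality for the maximal operator with respect
to the Hausdorff content. -/
theorem weak_type (d m : ℕ) (Φ : IFS d m) (p : Fin m → ℝ≥0∞)
    (μ : Measure (Pt d)) (hμ : Φ.SelfSimilar p μ)
    (s : ℝ) (hs : 0 < s) (hdim : ∑ i, Φ.r i ^ s = 1)
    (α : ℝ) (hα : 0 < α) (hαs : α ≤ s)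
    (f : Pt d → ℝ) (hmeas : Measurable f)
    (hf : choquetInt (Φ.hContent μ s α) Φ.K
      (fun x => ENNReal.ofReal |f x| ^ (α / s)) < ∞)
    (t : ℝ) (ht : 0 < t) :
    Φ.hContent μ s α {x ∈ Φ.K | ENNReal.ofReal t < Φ.maxOp μ f x} ≤
      ENNReal.ofReal (4 * (s / α) ^ (α / s) * t ^ (-(α / s))) *
        choquetInt (Φ.hContent μ s α) Φ.K
          (fun x => ENNReal.ofReal |f x| ^ (α / s)) := by
  have := hμ.2.2.1
  have hβ : 0 < α / s := div_pos hα hs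
  have hβ1 : α / s ≤ 1 := (div_le_one hs).2 hαs
  set A : Set (List (Fin m)) := {w | ENNReal.ofReal t <
    (μ (Φ.cyl w))⁻¹ * ∫⁻ y in Φ.cyl w, ENNReal.ofReal |f y| ∂μ}
  set c := (s / α) ^ (α / s) * t ^ (-(α / s))
  obtain ⟨F, hFJ, hpack, B, hB, hle⟩ := exists_packing_dominating
    (a := fun w => μ (Φ.cyl w) ^ (α / s))
    (fun w => ENNReal.rpow_ne_top_of_nonneg hβ.le (measure_ne_top _ _))
    (fun v w h => ENNReal.rpow_le_rpow (measure_mono (Φ.cyl_antitone h)) hβ.le)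
    (prefixMinimal A)
  have hcover : {x ∈ Φ.K | ENNReal.ofReal t < Φ.maxOp μ f x} ⊆ ⋃ w ∈ B, Φ.cyl w := by
    rintro x ⟨-, hx⟩
    simp only [IFS.maxOp, lt_iSup_iff] at hx
    obtain ⟨w, hxw, hw⟩ := hx
    obtain ⟨v, hv, hvw⟩ := exists_mem_prefixMinimal (A := A) hw
    obtain ⟨u, hu, huv⟩ := hB v hv
    exact mem_iUnion₂.2 ⟨u, hu, Φ.cyl_antitone (huv.trans hvw) hxw⟩
  calc Φ.hContent μ s α {x ∈ Φ.K | ENNReal.ofReal t < Φ.maxOp μ f x}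
      ≤ ∑' w : B, μ (Φ.cyl w.1) ^ (α / s) := Φ.hContent_le μ s α B hcover
    _ ≤ ∑' v : F, μ (Φ.cyl v.1) ^ (α / s) := hle
    _ ≤ ∑' v : F, ENNReal.ofReal c * choquetInt (Φ.hContent μ s α) (Φ.cyl v.1)
          (fun x => ENNReal.ofReal |f x| ^ (α / s)) :=
        ENNReal.tsum_le_tsum fun v =>
          Φ.measure_cyl_rpow_le μ s α hβ hβ1 hmeas ht (hFJ v.2).1
    _ ≤ ENNReal.ofReal c * (3 * choquetInt (Φ.hContent μ s α) Φ.K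
          (fun x => ENNReal.ofReal |f x| ^ (α / s))) := by
        rw [ENNReal.tsum_mul_left]
        gcongr
        exact Φ.tsum_choquetInt_cyl_le μ s α
          ((isAntichain_prefixMinimal A).subset hFJ) hpack _
    _ ≤ _ := by
        rw [mul_assoc 4, ENNReal.ofReal_mul (by norm_num : (0 : ℝ) ≤ 4), mul_left_comm, mul_assoc,
          ENNReal.ofReal_ofNat]
        gcongr
        norm_num
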